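/- arXiv:1405.6343 — 5 statements merged into one kernel-verified Lean document; each statement's English description precedes it below -/
import Mathlib

section
/- Let q : ℝ → ℂ, let λ₁, λ₂ ∈ ℂ with λ₁ ≠ λ₂, and let u₁, u₂ : ℝ → ℂ be twice differentiable with −uᵢ''(x) + q(x)uᵢ(x) = λᵢuᵢ(x) for all x, normalized by uᵢ(0) = 1 and uᵢ'(0) = −mᵢ (with m₁, m₂ ∈ ℂ). Assume that the product x ↦ u₁(x)u₂(x) is integrable on (−∞,0] and that u₁(x)u₂'(x) − u₁'(x)u₂(x) → 0 as x → −∞. Then ∫_{−∞}^0 u₁(x)u₂(x) dx = (m₁ − m₂)/(λ₁ − λ₂). -/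
open MeasureTheory Filter

/-- Energy variation of the left half-line Weyl–Titchmarsh function:
if `u₁, u₂` solve the Schrödinger equation at energies `λ₁ ≠ λ₂`, are normalized by
`uᵢ(0) = 1`, `uᵢ'(0) = -mᵢ`, their product is integrable on `(-∞,0]` and their Wronskian
tends to `0` at `-∞`, then `∫_{-∞}^0 u₁ u₂ = (m₁ - m₂)/(λ₁ - λ₂)`. -/
theorem integral_mul_eq_m_div_lam_left
    (q : ℝ → ℂ) (lam₁ lam₂ m₁ m₂ : ℂ) (hlam : lam₁ ≠ lam₂)
    (u₁ u₁' u₁'' u₂ u₂' u₂'' : ℝ → ℂ)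
    (hu₁ : ∀ x, HasDerivAt u₁ (u₁' x) x)
    (hu₁' : ∀ x, HasDerivAt u₁' (u₁'' x) x)
    (hu₂ : ∀ x, HasDerivAt u₂ (u₂' x) x)
    (hu₂' : ∀ x, HasDerivAt u₂' (u₂'' x) x)
    (heq₁ : ∀ x, -u₁'' x + q x * u₁ x = lam₁ * u₁ x)
    (heq₂ : ∀ x, -u₂'' x + q x * u₂ x = lam₂ * u₂ x)
    (hval₁ : u₁ 0 = 1) (hval₂ : u₂ 0 = 1)
    (hder₁ : u₁' 0 = -m₁) (hder₂ : u₂' 0 = -m₂)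
    (hint : IntegrableOn (fun x => u₁ x * u₂ x) (Set.Iic (0 : ℝ)))
    (hwron : Tendsto (fun x => u₁ x * u₂' x - u₁' x * u₂ x) atBot (nhds 0)) :
    ∫ x in Set.Iic (0 : ℝ), u₁ x * u₂ x = (m₁ - m₂) / (lam₁ - lam₂) := by
  have hderiv : ∀ x ∈ Set.Iic (0 : ℝ), HasDerivAt (fun x => u₁ x * u₂' x - u₁' x * u₂ x)
      ((lam₁ - lam₂) * (u₁ x * u₂ x)) x := fun x _ =>
    (((hu₁ x).mul (hu₂' x)).sub ((hu₁' x).mul (hu₂ x))).congr_deriv (by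
      linear_combination u₂ x * heq₁ x - u₁ x * heq₂ x)
  have h := integral_Iic_of_hasDerivAt_of_tendsto' hderiv (hint.const_mul (lam₁ - lam₂)) hwron
  rw [integral_const_mul, hval₁, hval₂, hder₁, hder₂] at h
  rw [eq_div_iff (sub_ne_zero.mpr hlam)]
  linear_combination h
end

section
/- Let q : ℝ → ℝ, λ ∈ ℂ, and m, m' ∈ ℂ. Let u, v : ℝ → ℂ be twice differentiable with −u''(x) + q(x)u(x) = λu(x) and −v''(x) + q(x)v(x) = λv(x) + u(x) for all x, normalized by u(0) = 1, u'(0) = m, v(0) = 0, v'(0) = m'. Assume x ↦ u(x)² is integrable on [0,∞) and u(x)v'(x) − u'(x)v(x) → 0 as x → ∞. Then ∫₀^∞ u(x)² dx = m'. -/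
open MeasureTheory Filter

/-- The identity `∫₀^∞ u(x)² dx = m'`, where `u` solves
`-u'' + q·u = λ·u` with `u(0) = 1`, `u'(0) = m`, and `v` (the λ-derivative of `u`)
solves the inhomogeneous equation `-v'' + q·v = λ·v + u` with `v(0) = 0`, `v'(0) = m'`,
assuming `u²` is integrable on `[0,∞)` and the mixed Wronskian `u·v' - u'·v` tends
to `0` at `+∞`. -/
theorem integral_sq_eq_deriv_m
    (q : ℝ → ℝ) (lam m m' : ℂ)
    (u u' u'' v v' v'' : ℝ → ℂ)
    (hu : ∀ x, HasDerivAt u (u' x) x)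
    (hu' : ∀ x, HasDerivAt u' (u'' x) x)
    (hv : ∀ x, HasDerivAt v (v' x) x)
    (hv' : ∀ x, HasDerivAt v' (v'' x) x)
    (hequ : ∀ x, -u'' x + (q x : ℂ) * u x = lam * u x)
    (heqv : ∀ x, -v'' x + (q x : ℂ) * v x = lam * v x + u x)
    (hu0 : u 0 = 1) (hu'0 : u' 0 = m)
    (hv0 : v 0 = 0) (hv'0 : v' 0 = m')
    (hint : IntegrableOn (fun x => (u x) ^ 2) (Set.Ici (0 : ℝ)))
    (hwron : Tendsto (fun x => u x * v' x - u' x * v x) atTop (nhds 0)) :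
    ∫ x in Set.Ici (0 : ℝ), (u x) ^ 2 = m' := by
  have hderiv : ∀ x ∈ Set.Ici (0 : ℝ),
      HasDerivAt (fun x => u x * v' x - u' x * v x) (-(u x) ^ 2) x := by
    intro x _
    refine (((hu x).mul (hv' x)).sub ((hu' x).mul (hv x))).congr_deriv ?_
    linear_combination v x * hequ x - u x * heqv x
  have h := integral_Ioi_of_hasDerivAt_of_tendsto' hderiv
    (hint.mono_set Set.Ioi_subset_Ici_self).neg hwron
  rw [integral_neg, hu0, hv0, hv'0] at h
  rw [integral_Ici_eq_integral_Ioi]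
  linear_combination -h
end

section
/- Let q : ℝ → ℝ be real-valued and continuous, λ ∈ ℂ with Im λ > 0, and let u₁, u₂ : ℝ → ℂ be twice differentiable with −uᵢ''(x) + q(x)uᵢ(x) = λuᵢ(x) for all x, subject to the initial conditions u₁(0) = 1, u₁'(0) = 0, u₂(0) = 0, u₂'(0) = 1. Define 𝔄(x) as the 2×2 matrix with rows (u₁(x), u₁'(x)) and (u₂(x), u₂'(x)), 𝔍 as the matrix with rows (0, −1), (1, 0), and P as the matrix with rows (1, 0), (0, 0). Then for every ℓ ≥ 0: (i) 𝔍 − 𝔄(ℓ)·𝔍·𝔄(ℓ)ᴴ = (λ − conj(λ))·∫₀^ℓ 𝔄(x)·P·𝔄(x)ᴴ dx; and (ii) the Hermitian matrix (λ − conj(λ))^{−1}·(𝔄(ℓ)·𝔍·𝔄(ℓ)ᴴ − 𝔍) is negative semidefinite. -/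
open Matrix ComplexOrder

/-- Green's identity: the modified Wronskian of two solutions of `-u'' + q·u = lam·u` is
the initial value minus a multiple of their `L²` pairing. -/
lemma wronskian_conj_eq_sub_integral {q : ℝ → ℝ} {lam : ℂ} {u u' u'' v v' v'' : ℝ → ℂ}
    (hu : ∀ x, HasDerivAt u (u' x) x) (hu' : ∀ x, HasDerivAt u' (u'' x) x)
    (hv : ∀ x, HasDerivAt v (v' x) x) (hv' : ∀ x, HasDerivAt v' (v'' x) x)
    (hequ : ∀ x, -u'' x + (q x : ℂ) * u x = lam * u x)
    (heqv : ∀ x, -v'' x + (q x : ℂ) * v x = lam * v x) (a b : ℝ) :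
    (u' a * star (v a) - u a * star (v' a)) - (u' b * star (v b) - u b * star (v' b)) =
      (lam - star lam) * ∫ x in a..b, u x * star (v x) := by
  have hcu : Continuous u := continuous_iff_continuousAt.2 fun x => (hu x).continuousAt
  have hcv : Continuous v := continuous_iff_continuousAt.2 fun x => (hv x).continuousAt
  have hderiv : ∀ x, HasDerivAt (fun x => u' x * star (v x) - u x * star (v' x))
      (-((lam - star lam) * (u x * star (v x)))) x := by
    intro x
    refine (((hu' x).mul (hv x).star).sub ((hu x).mul (hv' x).star)).congr_deriv ?_
    have hu2 : u'' x = (q x : ℂ) * u x - lam * u x := by linear_combination -hequ x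
    have hv2 : v'' x = (q x : ℂ) * v x - lam * v x := by linear_combination -heqv x
    have hq : star (q x : ℂ) = q x := Complex.conj_ofReal _
    rw [hu2, hv2, star_sub, star_mul', star_mul', hq]
    ring
  have hftc := intervalIntegral.integral_eq_sub_of_hasDerivAt (a := a) (b := b)
    (fun x _ => hderiv x) (Continuous.intervalIntegrable (by fun_prop) a b)
  rw [intervalIntegral.integral_neg, intervalIntegral.integral_const_mul] at hftc
  linear_combination hftc

/-- The Gram matrix of continuous functions on an interval is positive semidefinite. -/
lemma posSemidef_integral_mul_star {ι : Type*} [Fintype ι] {w : ι → ℝ → ℂ}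
    (hw : ∀ i, Continuous (w i)) {a b : ℝ} (hab : a ≤ b) :
    (Matrix.of fun i j => ∫ x in a..b, w i x * star (w j x)).PosSemidef := by
  refine PosSemidef.of_dotProduct_mulVec_nonneg ?_ fun y => ?_
  · ext i j
    simp only [conjTranspose_apply, of_apply]
    refine (intervalIntegral.intervalIntegral_conj
      (f := fun x => w j x * star (w i x))).symm.trans ?_
    refine intervalIntegral.integral_congr fun x _ => ?_
    simp [mul_comm]
  · have hsum : star y ⬝ᵥ (Matrix.of fun i j => ∫ x in a..b, w i x * star (w j x)) *ᵥ y =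
        ∫ x in a..b, ((‖∑ i, star (y i) * w i x‖ ^ 2 : ℝ) : ℂ) := by
      have hpt : ∀ x, ((‖∑ i, star (y i) * w i x‖ ^ 2 : ℝ) : ℂ) =
          ∑ i, ∑ j, star (y i) * ((w i x * star (w j x)) * y j) := by
        intro x
        rw [Complex.ofReal_pow, ← Complex.mul_conj', map_sum, Finset.sum_mul_sum]
        refine Finset.sum_congr rfl fun i _ => Finset.sum_congr rfl fun j _ => ?_
        simp
        ring
      simp_rw [hpt]
      rw [intervalIntegral.integral_finsetSum
        fun i _ => Continuous.intervalIntegrable (by fun_prop) a b]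
      refine Finset.sum_congr rfl fun i _ => ?_
      rw [intervalIntegral.integral_finsetSum
        fun j _ => Continuous.intervalIntegrable (by fun_prop) a b]
      simp only [mulVec, dotProduct, of_apply, Pi.star_apply, Finset.mul_sum,
        intervalIntegral.integral_const_mul, intervalIntegral.integral_mul_const]
    rw [hsum, intervalIntegral.integral_ofReal]
    exact_mod_cast intervalIntegral.integral_nonneg hab fun x _ => by positivity

/-- Lemma 4.1 of the paper (𝔍-contraction property of transfer
matrices): with `𝔄(x)` the transfer matrix of `-u'' + q·u = λ·u` normalized to the
identity at `0`, for every `ℓ ≥ 0` one has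
`𝔍 - 𝔄(ℓ)·𝔍·𝔄(ℓ)ᴴ = (λ - conj λ)·∫₀^ℓ 𝔄(x)·P·𝔄(x)ᴴ dx` (entrywise), and the matrix
`(λ - conj λ)⁻¹·(𝔄(ℓ)·𝔍·𝔄(ℓ)ᴴ - 𝔍)` is negative semidefinite. -/
theorem transfer_matrix_J_contraction
    (q : ℝ → ℝ) (hq : Continuous q) (lam : ℂ) (hlam : 0 < lam.im)
    (u₁ u₁' u₁'' u₂ u₂' u₂'' : ℝ → ℂ)
    (hu₁ : ∀ x, HasDerivAt u₁ (u₁' x) x)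
    (hu₁' : ∀ x, HasDerivAt u₁' (u₁'' x) x)
    (hu₂ : ∀ x, HasDerivAt u₂ (u₂' x) x)
    (hu₂' : ∀ x, HasDerivAt u₂' (u₂'' x) x)
    (heq₁ : ∀ x, -u₁'' x + (q x : ℂ) * u₁ x = lam * u₁ x)
    (heq₂ : ∀ x, -u₂'' x + (q x : ℂ) * u₂ x = lam * u₂ x)
    (h10 : u₁ 0 = 1) (h1'0 : u₁' 0 = 0) (h20 : u₂ 0 = 0) (h2'0 : u₂' 0 = 1)
    (A : ℝ → Matrix (Fin 2) (Fin 2) ℂ)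
    (J P : Matrix (Fin 2) (Fin 2) ℂ)
    (hA : ∀ x, A x = Matrix.of ![![u₁ x, u₁' x], ![u₂ x, u₂' x]])
    (hJ : J = Matrix.of ![![0, -1], ![1, 0]])
    (hP : P = Matrix.of ![![1, 0], ![0, 0]]) :
    ∀ ℓ : ℝ, 0 ≤ ℓ →
      (∀ i j, (J - A ℓ * J * (A ℓ)ᴴ) i j =
        (lam - (starRingEnd ℂ) lam) * ∫ x in (0:ℝ)..ℓ, (A x * P * (A x)ᴴ) i j) ∧
      Matrix.PosSemidef (-((lam - (starRingEnd ℂ) lam)⁻¹ • (A ℓ * J * (A ℓ)ᴴ - J))) := by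
  intro ℓ hℓ
  have hc₁ : Continuous u₁ := continuous_iff_continuousAt.2 fun x => (hu₁ x).continuousAt
  have hc₂ : Continuous u₂ := continuous_iff_continuousAt.2 fun x => (hu₂ x).continuousAt
  have hgram : ∀ x i j, (A x * P * (A x)ᴴ) i j = ![u₁, u₂] i x * star (![u₁, u₂] j x) := by
    intro x i j
    rw [hA, hP]
    fin_cases i <;> fin_cases j <;> simp [Matrix.mul_apply, Fin.sum_univ_two]
  have hmain : ∀ i j, (J - A ℓ * J * (A ℓ)ᴴ) i j =
      (lam - (starRingEnd ℂ) lam) * ∫ x in (0:ℝ)..ℓ, (A x * P * (A x)ᴴ) i j := by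
    intro i j
    simp_rw [hgram]
    have h₁₁ := wronskian_conj_eq_sub_integral hu₁ hu₁' hu₁ hu₁' heq₁ heq₁ 0 ℓ
    have h₁₂ := wronskian_conj_eq_sub_integral hu₁ hu₁' hu₂ hu₂' heq₁ heq₂ 0 ℓ
    have h₂₁ := wronskian_conj_eq_sub_integral hu₂ hu₂' hu₁ hu₁' heq₂ heq₁ 0 ℓ
    have h₂₂ := wronskian_conj_eq_sub_integral hu₂ hu₂' hu₂ hu₂' heq₂ heq₂ 0 ℓ
    simp only [h10, h1'0, h20, h2'0] at h₁₁ h₁₂ h₂₁ h₂₂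
    rw [hA, hJ]
    fin_cases i <;> fin_cases j
    · refine Eq.trans ?_ h₁₁
      simp [vecMul, dotProduct, Fin.sum_univ_two]
      ring
    · refine Eq.trans ?_ h₁₂
      simp [vecMul, dotProduct, Fin.sum_univ_two]
      ring
    · refine Eq.trans ?_ h₂₁
      simp [vecMul, dotProduct, Fin.sum_univ_two]
      ring
    · refine Eq.trans ?_ h₂₂
      simp [vecMul, dotProduct, Fin.sum_univ_two]
      ring
  refine ⟨hmain, ?_⟩
  have hne : lam - (starRingEnd ℂ) lam ≠ 0 := by
    rw [Complex.sub_conj]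
    simp [hlam.ne']
  have hpos := posSemidef_integral_mul_star (w := ![u₁, u₂])
    (Fin.forall_fin_two.2 ⟨hc₁, hc₂⟩) hℓ
  convert hpos using 1
  ext i j
  have hij := hmain i j
  simp_rw [hgram] at hij
  rw [← smul_neg, neg_sub, Matrix.smul_apply, hij, of_apply, smul_eq_mul, inv_mul_cancel_left₀ hne]
end

section
/- Let q : ℝ → ℝ be bounded and continuous and let λ ∈ ℂ with Im λ ≠ 0. If u, v : ℝ → ℂ are twice differentiable functions satisfying −w''(x) + q(x)w(x) = λw(x) for all x ≥ 0 (with w = u and w = v), and both |u|² and |v|² are integrable on [0,∞), then u and v are linearly dependent on [0,∞): there exist complex numbers c₁, c₂, not both zero, with c₁u(x) + c₂v(x) = 0 for all x ≥ 0. -/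
open MeasureTheory

open Filter Topology ComplexConjugate

theorem tendsto_atTop_of_pos_le_deriv {f f' : ℝ → ℝ} {a m : ℝ} (hm : 0 < m)
    (hf : ∀ x, a ≤ x → HasDerivAt f (f' x) x) (hle : ∀ x, a ≤ x → m ≤ f' x) :
    Tendsto f atTop atTop := by
  have hlin : Tendsto (fun x => m * (x - a) + f a) atTop atTop :=
    tendsto_atTop_add_const_right _ _
      ((tendsto_atTop_add_const_right _ (-a) tendsto_id).const_mul_atTop hm)
  refine tendsto_atTop_mono' _ ?_ hlin
  filter_upwards [eventually_ge_atTop a] with x hx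
  have h := (convex_Ici a).mul_sub_le_image_sub_of_le_deriv (f := f) (C := m)
    (fun y hy => (hf y hy).continuousAt.continuousWithinAt)
    (fun y hy => (hf y (interior_subset hy)).differentiableAt.differentiableWithinAt)
    (fun y hy => by
      rw [(hf y (interior_subset hy)).deriv]
      exact hle y (interior_subset hy))
    a Set.self_mem_Ici x hx hx
  linarith

/-- A function `H` on a half-line cannot be bounded above if `H''' ≥ 2 * (c - K * H')`
with `c > 0`, `K ≥ 0`. -/
theorem not_bddAbove_of_le_third_deriv {H N G D : ℝ → ℝ} {a c K C : ℝ} (hc : 0 < c) (hK : 0 ≤ K)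
    (hH : ∀ x, a ≤ x → HasDerivAt H (N x) x)
    (hN : ∀ x, a ≤ x → HasDerivAt N (2 * G x) x)
    (hG : ∀ x, a ≤ x → HasDerivAt G (D x) x)
    (hD : ∀ x, a ≤ x → c - K * N x ≤ D x) : ¬ ∀ x, a ≤ x → H x ≤ C := by
  intro hb
  have hGH : Tendsto (fun x => G x + K * H x) atTop atTop :=
    tendsto_atTop_of_pos_le_deriv (a := a) hc
      (fun x hx => (hG x hx).add ((hH x hx).const_mul K))
      (fun x hx => by linarith [hD x hx])
  obtain ⟨b, hab, hGb⟩ : ∃ b, a ≤ b ∧ ∀ x, b ≤ x → 1 ≤ G x := by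
    obtain ⟨b, hb'⟩ := eventually_atTop.1 (hGH.eventually_ge_atTop (1 + K * C))
    refine ⟨max a b, le_max_left _ _, fun x hx => ?_⟩
    have h1 := hb' x ((le_max_right _ _).trans hx)
    have h2 := mul_le_mul_of_nonneg_left (hb x ((le_max_left _ _).trans hx)) hK
    linarith
  have hNt : Tendsto N atTop atTop :=
    tendsto_atTop_of_pos_le_deriv (a := b) two_pos (fun x hx => hN x (hab.trans hx))
      (fun x hx => by linarith [hGb x hx])
  obtain ⟨d, hd⟩ := eventually_atTop.1 (hNt.eventually_ge_atTop 1)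
  have hHt : Tendsto H atTop atTop :=
    tendsto_atTop_of_pos_le_deriv (a := max a d) one_pos
      (fun x hx => hH x ((le_max_left _ _).trans hx))
      (fun x hx => hd x ((le_max_right _ _).trans hx))
  obtain ⟨x, hx, hxa⟩ := ((hHt.eventually_gt_atTop C).and (eventually_ge_atTop a)).exists
  exact (hb x hxa).not_gt hx

/-- A solution of `-w'' + q w = λ w` on `[0, ∞)` with bounded potential, `Im λ ≠ 0` and the
Dirichlet condition `w 0 = 0` vanishes identically if it is square-integrable. -/
theorem dirichlet_solution_eq_zero_of_integrableOn_sq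
    {q : ℝ → ℝ} {M : ℝ} (hq : ∀ x, |q x| ≤ M) {lam : ℂ} (hlam : lam.im ≠ 0)
    {w w' w'' : ℝ → ℂ} (hw : ∀ x, HasDerivAt w (w' x) x) (hw' : ∀ x, HasDerivAt w' (w'' x) x)
    (heq : ∀ x, 0 ≤ x → -w'' x + (q x : ℂ) * w x = lam * w x)
    (hint : IntegrableOn (fun x => ‖w x‖ ^ 2) (Set.Ici (0 : ℝ))) (hw0 : w 0 = 0) :
    ∀ x, 0 ≤ x → w x = 0 := by
  by_contra! hne
  obtain ⟨x₀, hx₀, hwx₀⟩ := hne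
  set N : ℝ → ℝ := fun x => ‖w x‖ ^ 2 with hNdef
  set H : ℝ → ℝ := fun x => ∫ t in (0 : ℝ)..x, N t with hHdef
  set P : ℝ → ℂ := fun x => conj (w x) * w' x with hPdef
  have hwc : Continuous w := continuous_iff_continuousAt.2 fun x => (hw x).continuousAt
  have hNc : Continuous N := by fun_prop
  have hN0 : ∀ x, 0 ≤ N x := fun x => sq_nonneg _
  have hH : ∀ x, HasDerivAt H (N x) x := fun x => hNc.integral_hasStrictDerivAt 0 x |>.hasDerivAt
  have hNd : ∀ x, HasDerivAt N (2 * (P x).re) x := fun x => by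
    have h := (hw x).norm_sq
    rwa [Complex.inner, mul_comm (w' x)] at h
  have hP : ∀ x, HasDerivAt P (conj (w' x) * w' x + conj (w x) * w'' x) x := fun x =>
    (hw x).star.mul (hw' x)
  have hP' : ∀ x, 0 ≤ x → conj (w' x) * w' x + conj (w x) * w'' x
      = ((‖w' x‖ ^ 2 : ℝ) : ℂ) + ((q x : ℂ) - lam) * ((N x : ℝ) : ℂ) := fun x hx => by
    have h2 : w'' x = ((q x : ℂ) - lam) * w x := by linear_combination -heq x hx
    rw [h2, mul_left_comm, Complex.conj_mul', Complex.conj_mul']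
    push_cast [hNdef]
    rfl
  have hRe : ∀ x, 0 ≤ x → HasDerivAt (fun y => (P y).re)
      (‖w' x‖ ^ 2 + (q x - lam.re) * N x) x := fun x hx => by
    have h := Complex.reCLM.hasFDerivAt.comp_hasDerivAt x (hP x)
    rw [hP' x hx] at h
    refine h.congr_deriv ?_
    simp [-Complex.ofReal_pow]
  have hIm : ∀ x, 0 ≤ x → HasDerivAt (fun y => (P y).im) (-lam.im * N x) x := fun x hx => by
    have h := Complex.imCLM.hasFDerivAt.comp_hasDerivAt x (hP x)
    rw [hP' x hx] at h
    refine h.congr_deriv ?_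
    simp [-Complex.ofReal_pow]
  have hImH : ∀ x, 0 ≤ x → (P x).im = -lam.im * H x := fun x hx => by
    have h := intervalIntegral.integral_eq_sub_of_hasDerivAt (a := 0) (b := x)
      (fun y hy => hIm y (by rw [Set.uIcc_of_le hx] at hy; exact hy.1))
      ((hNc.const_mul _).intervalIntegrable _ _)
    rw [intervalIntegral.integral_const_mul] at h
    simpa [hPdef, hw0] using h.symm
  have hHmono : Monotone H :=
    monotone_of_deriv_nonneg (fun x => (hH x).differentiableAt)
      (fun x => by rw [(hH x).deriv]; exact hN0 x)
  have ha : (0 : ℝ) < x₀ + 1 := by linarith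
  have hHpos : 0 < H (x₀ + 1) :=
    intervalIntegral.integral_pos ha hNc.continuousOn (fun x _ => hN0 x)
      ⟨x₀, ⟨hx₀, by linarith⟩, by positivity⟩
  have hM : 0 ≤ M := (abs_nonneg _).trans (hq 0)
  refine not_bddAbove_of_le_third_deriv (H := H) (N := N) (a := x₀ + 1)
    (c := 2 * (|lam.im| * H (x₀ + 1))) (K := M + |lam.re| + 1) (C := ∫ x in Set.Ici 0, N x)
    (by positivity) (by positivity) (fun x _ => hH x) (fun x _ => hNd x)
    (fun x hx => hRe x (ha.le.trans hx)) (fun x hx => ?_) (fun x hx => ?_)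
  · have h1 : |lam.im| * H (x₀ + 1) ≤ ‖w x‖ * ‖w' x‖ :=
      calc |lam.im| * H (x₀ + 1) ≤ |lam.im| * H x :=
            mul_le_mul_of_nonneg_left (hHmono hx) (abs_nonneg _)
        _ = |(P x).im| := by
            rw [hImH x (ha.le.trans hx), abs_mul, abs_neg,
              abs_of_nonneg (hHpos.le.trans (hHmono hx))]
        _ ≤ ‖P x‖ := Complex.abs_im_le_norm _
        _ = ‖w x‖ * ‖w' x‖ := by simp [hPdef]
    have h2 : -(M + |lam.re|) * N x ≤ (q x - lam.re) * N x :=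
      mul_le_mul_of_nonneg_right
        (by linarith [(abs_le.1 (hq x)).1, le_abs_self lam.re]) (hN0 x)
    have h3 : 2 * (‖w x‖ * ‖w' x‖) ≤ N x + ‖w' x‖ ^ 2 := by
      linarith [two_mul_le_add_sq ‖w x‖ ‖w' x‖]
    linarith
  · rw [hHdef]
    simp only
    rw [intervalIntegral.integral_of_le (ha.le.trans hx)]
    exact setIntegral_mono_set hint (ae_of_all _ hN0)
      (Set.Ioc_subset_Ioi_self.trans Set.Ioi_subset_Ici_self).eventuallyLE

/-- Limit-point property for bounded continuous potentials: if
`Im λ ≠ 0` and `u, v` are twice differentiable solutions of `-w'' + q·w = λ·w` on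
`[0,∞)` whose squared moduli are integrable on `[0,∞)`, then `u` and `v` are linearly
dependent on `[0,∞)`. -/
theorem weyl_solution_unique_up_to_constant
    (q : ℝ → ℝ) (hqc : Continuous q) (hqb : ∃ M : ℝ, ∀ x, |q x| ≤ M)
    (lam : ℂ) (hlam : lam.im ≠ 0)
    (u u' u'' v v' v'' : ℝ → ℂ)
    (hu : ∀ x, HasDerivAt u (u' x) x)
    (hu' : ∀ x, HasDerivAt u' (u'' x) x)
    (hv : ∀ x, HasDerivAt v (v' x) x)
    (hv' : ∀ x, HasDerivAt v' (v'' x) x)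
    (hequ : ∀ x, 0 ≤ x → -u'' x + (q x : ℂ) * u x = lam * u x)
    (heqv : ∀ x, 0 ≤ x → -v'' x + (q x : ℂ) * v x = lam * v x)
    (hintu : IntegrableOn (fun x => ‖u x‖ ^ 2) (Set.Ici (0 : ℝ)))
    (hintv : IntegrableOn (fun x => ‖v x‖ ^ 2) (Set.Ici (0 : ℝ))) :
    ∃ c₁ c₂ : ℂ, ¬(c₁ = 0 ∧ c₂ = 0) ∧ ∀ x : ℝ, 0 ≤ x → c₁ * u x + c₂ * v x = 0 := by
  obtain ⟨M, hM⟩ := hqb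
  obtain ⟨c₁, c₂, hc, h0⟩ : ∃ c₁ c₂ : ℂ, ¬(c₁ = 0 ∧ c₂ = 0) ∧ c₁ * u 0 + c₂ * v 0 = 0 := by
    by_cases h : u 0 = 0
    · exact ⟨1, 0, by simp, by simp [h]⟩
    · exact ⟨v 0, -u 0, by simp [h], by ring⟩
  have huc : Continuous u := continuous_iff_continuousAt.2 fun x => (hu x).continuousAt
  have hvc : Continuous v := continuous_iff_continuousAt.2 fun x => (hv x).continuousAt
  refine ⟨c₁, c₂, hc, dirichlet_solution_eq_zero_of_integrableOn_sq hM hlam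
    (fun x => ((hu x).const_mul c₁).add ((hv x).const_mul c₂))
    (fun x => ((hu' x).const_mul c₁).add ((hv' x).const_mul c₂))
    (fun x hx => ?_) ?_ h0⟩
  · linear_combination c₁ * hequ x hx + c₂ * heqv x hx
  · refine Integrable.mono' ((hintu.const_mul (2 * ‖c₁‖ ^ 2)).add (hintv.const_mul (2 * ‖c₂‖ ^ 2)))
      (by fun_prop) (ae_of_all _ fun x => ?_)
    have h1 : ‖c₁ * u x + c₂ * v x‖ ≤ ‖c₁‖ * ‖u x‖ + ‖c₂‖ * ‖v x‖ := by
      simpa using norm_add_le (c₁ * u x) (c₂ * v x)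
    have h2 := pow_le_pow_left₀ (norm_nonneg _) h1 2
    rw [Real.norm_of_nonneg (sq_nonneg _), Pi.add_apply]
    linarith [two_mul_le_add_sq (‖c₁‖ * ‖u x‖) (‖c₂‖ * ‖v x‖)]
end

section
/- Let x₀ > 0, C ≥ 0, and let ρ : ℝ → ℝ be a measurable function with 0 ≤ ρ(x) ≤ C for all x. Then: (i) the limit as y → ∞ of (1/π)·∫_ℝ (x² − x₀²/2 − y²)·ρ(x) / (((x − x₀)² + y²)·(x² + y²)) dx equals 0; and (ii) if moreover for every y > 0 one has (1/π)·∫_ℝ (x² − x₀²/2 − y²)·ρ(x) / (((x − x₀)² + y²)·(x² + y²)) dx = 2π/x₀ − 1, then x₀ = 2π. -/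
open MeasureTheory Filter Real

/-- The kernel `(x² - a²/2 - y²) / (((x - a)² + y²) (x² + y²))` is dominated by
`2 / ((x - a)² + y²)` as soon as `y ≥ a > 0`. -/
theorem norm_comb_kernel_mul_le {a C r x y : ℝ} (ha : 0 < a) (hy : a ≤ y)
    (hr : 0 ≤ r) (hrC : r ≤ C) :
    ‖(x ^ 2 - a ^ 2 / 2 - y ^ 2) * r / (((x - a) ^ 2 + y ^ 2) * (x ^ 2 + y ^ 2))‖ ≤
      2 * C / ((x - a) ^ 2 + y ^ 2) := by
  have hy0 : 0 < y := ha.trans_le hy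
  have h₁ : 0 < (x - a) ^ 2 + y ^ 2 := by positivity
  have h₂ : 0 < x ^ 2 + y ^ 2 := by positivity
  have hsq : a ^ 2 ≤ y ^ 2 := by gcongr
  have hnum : |x ^ 2 - a ^ 2 / 2 - y ^ 2| ≤ 2 * (x ^ 2 + y ^ 2) :=
    abs_le.2 ⟨by nlinarith [sq_nonneg x], by nlinarith [sq_nonneg x, sq_nonneg a]⟩
  rw [Real.norm_eq_abs, abs_div, abs_mul, abs_of_nonneg hr, abs_of_pos (mul_pos h₁ h₂),
    div_le_div_iff₀ (mul_pos h₁ h₂) h₁]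
  calc |x ^ 2 - a ^ 2 / 2 - y ^ 2| * r * ((x - a) ^ 2 + y ^ 2)
      ≤ 2 * (x ^ 2 + y ^ 2) * C * ((x - a) ^ 2 + y ^ 2) := by gcongr
    _ = 2 * C * (((x - a) ^ 2 + y ^ 2) * (x ^ 2 + y ^ 2)) := by ring

theorem tendsto_integral_comb_kernel_mul {a C : ℝ} (ha : 0 < a) {ρ : ℝ → ℝ}
    (hmeas : Measurable ρ) (hρ : ∀ x, 0 ≤ ρ x ∧ ρ x ≤ C) :
    Tendsto (fun y : ℝ => ∫ x : ℝ, (x ^ 2 - a ^ 2 / 2 - y ^ 2) * ρ x /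
      (((x - a) ^ 2 + y ^ 2) * (x ^ 2 + y ^ 2))) atTop (nhds 0) := by
  have hC : 0 ≤ C := (hρ 0).1.trans (hρ 0).2
  rw [← integral_zero ℝ ℝ (μ := volume)]
  refine tendsto_integral_filter_of_dominated_convergence
    (fun x => 2 * C * (1 + (x - a) ^ 2)⁻¹) ?_ ?_ ?_ ?_
  · exact Eventually.of_forall fun y => by
      apply Measurable.aestronglyMeasurable
      fun_prop
  · filter_upwards [eventually_ge_atTop a, eventually_ge_atTop 1] with y hy hy1
    refine Eventually.of_forall fun x => ?_
    refine (norm_comb_kernel_mul_le ha hy (hρ x).1 (hρ x).2).trans ?_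
    rw [← div_eq_mul_inv]
    gcongr 2 * C / ?_
    nlinarith
  · exact (integrable_inv_one_add_sq.comp_sub_right a).const_mul _
  · refine Eventually.of_forall fun x => ?_
    have hlim : Tendsto (fun y : ℝ => 2 * C / ((x - a) ^ 2 + y ^ 2)) atTop (nhds 0) :=
      tendsto_const_nhds.div_atTop
        (tendsto_atTop_add_const_left _ _ (tendsto_pow_atTop two_ne_zero))
    refine squeeze_zero_norm' ?_ hlim
    filter_upwards [eventually_ge_atTop a] with y hy
    exact norm_comb_kernel_mul_le ha hy (hρ x).1 (hρ x).2

/-- The analytic core of Lemma A.1 of the paper: for a measurable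
`ρ` with `0 ≤ ρ ≤ C` and `x₀ > 0`, the integral
`F(y) = (1/π)·∫_ℝ (x² - x₀²/2 - y²)·ρ(x) / (((x - x₀)² + y²)·(x² + y²)) dx`
tends to `0` as `y → ∞`; consequently, if `F(y) = 2π/x₀ - 1` for all `y > 0`,
then `x₀ = 2π`. -/
theorem comb_periodicity_integral
    (x₀ C : ℝ) (hx₀ : 0 < x₀) (hC : 0 ≤ C)
    (ρ : ℝ → ℝ) (hmeas : Measurable ρ)
    (hρ : ∀ x, 0 ≤ ρ x ∧ ρ x ≤ C)
    (F : ℝ → ℝ)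
    (hF : ∀ y : ℝ, F y =
      (1 / π) * ∫ x : ℝ,
        (x ^ 2 - x₀ ^ 2 / 2 - y ^ 2) * ρ x /
          (((x - x₀) ^ 2 + y ^ 2) * (x ^ 2 + y ^ 2))) :
    Tendsto F atTop (nhds 0) ∧
      ((∀ y : ℝ, 0 < y → F y = 2 * π / x₀ - 1) → x₀ = 2 * π) := by
  have hlim : Tendsto F atTop (nhds 0) := by
    rw [funext hF]
    simpa using (tendsto_integral_comb_kernel_mul hx₀ hmeas hρ).const_mul (1 / π)
  refine ⟨hlim, fun h => ?_⟩
  have hconst : Tendsto F atTop (nhds (2 * π / x₀ - 1)) :=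
    tendsto_const_nhds.congr' <| by
      filter_upwards [eventually_gt_atTop 0] with y hy
      exact (h y hy).symm
  have heq : 2 * π / x₀ = 1 := sub_eq_zero.1 (tendsto_nhds_unique hconst hlim)
  exact ((div_eq_one_iff_eq hx₀.ne').1 heq).symm
end
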